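/- Let b ∈ ℝ with b ≠ −3 and b ≠ −1, and let ε = ±1. Consider the Type B connection on the half-plane {x¹ > 0} with Christoffel symbols Γ_{11}^1 = b/x¹, Γ_{12}^2 = Γ_{21}^2 = (b+1)/x¹, Γ_{22}^1 = ε/x¹ and all other Γ_{ij}^k = 0; its symmetrized Ricci tensor is ρ_s = −2ε(x¹)^{-2}·dx²⊗dx². Then for μ = (b+1)/2, the set of smooth f on {x¹ > 0} satisfying (Hf)₁₁ = 0, (Hf)₁₂ = 0 and (Hf)₂₂ = −ε(b+1)(x¹)^{-2}·f (the affine quasi-Einstein equation with eigenvalue μ = (b+1)/2) is exactly the real span of the two functions (x¹)^{b+1} and (x¹)^{b+1}·x². -/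

import Mathlib

/-- Partial derivative in the first coordinate direction. -/
noncomputable def pd1 (f : ℝ × ℝ → ℝ) : ℝ × ℝ → ℝ := fun p => fderiv ℝ f p (1, 0)

/-- Partial derivative in the second coordinate direction. -/
noncomputable def pd2 (f : ℝ × ℝ → ℝ) : ℝ × ℝ → ℝ := fun p => fderiv ℝ f p (0, 1)


lemma aux_open : IsOpen {p : ℝ × ℝ | 0 < p.1} := isOpen_lt continuous_const continuous_fst

lemma aux_const (g : ℝ × ℝ → ℝ) (hd : ∀ p : ℝ × ℝ, 0 < p.1 → DifferentiableAt ℝ g p)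
    (h1 : ∀ p : ℝ × ℝ, 0 < p.1 → pd1 g p = 0) (h2 : ∀ p : ℝ × ℝ, 0 < p.1 → pd2 g p = 0) :
    ∃ K, ∀ p : ℝ × ℝ, 0 < p.1 → g p = K := by
  refine ⟨g (1, 0), fun p hp => ?_⟩
  have hconv : Convex ℝ {p : ℝ × ℝ | 0 < p.1} :=
    convex_halfSpace_gt (IsLinearMap.mk (fun _ _ => rfl) (fun _ _ => rfl)) 0
  refine aux_open.is_const_of_fderiv_eq_zero (𝕜 := ℝ) hconv.isPreconnected
    (fun q hq => (hd q hq).differentiableWithinAt) ?_ hp (by simp)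
  intro q hq
  have e1 := h1 q hq
  have e2 := h2 q hq
  unfold pd1 at e1
  unfold pd2 at e2
  ext
  · simpa using e1
  · simpa using e2

lemma aux_mul1 {g h : ℝ × ℝ → ℝ} {p : ℝ × ℝ} (hg : DifferentiableAt ℝ g p)
    (hh : DifferentiableAt ℝ h p) :
    pd1 (fun q => g q * h q) p = g p * pd1 h p + h p * pd1 g p := by
  simp [pd1, fderiv_fun_mul hg hh]

lemma aux_mul2 {g h : ℝ × ℝ → ℝ} {p : ℝ × ℝ} (hg : DifferentiableAt ℝ g p)
    (hh : DifferentiableAt ℝ h p) :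
    pd2 (fun q => g q * h q) p = g p * pd2 h p + h p * pd2 g p := by
  simp [pd2, fderiv_fun_mul hg hh]

lemma aux_sub1 {g h : ℝ × ℝ → ℝ} {p : ℝ × ℝ} (hg : DifferentiableAt ℝ g p)
    (hh : DifferentiableAt ℝ h p) :
    pd1 (fun q => g q - h q) p = pd1 g p - pd1 h p := by
  simp [pd1, fderiv_fun_sub hg hh]

lemma aux_sub2 {g h : ℝ × ℝ → ℝ} {p : ℝ × ℝ} (hg : DifferentiableAt ℝ g p)
    (hh : DifferentiableAt ℝ h p) :
    pd2 (fun q => g q - h q) p = pd2 g p - pd2 h p := by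
  simp [pd2, fderiv_fun_sub hg hh]

lemma aux_prod (f : ℝ × ℝ → ℝ) (ψ : ℝ → ℝ) (a d ψ' : ℝ) (p : ℝ × ℝ) (hp : 0 < p.1)
    (hf : ∀ q : ℝ × ℝ, 0 < q.1 → f q = ψ q.1 * (a + d * q.2)) (hψ : HasDerivAt ψ ψ' p.1) :
    DifferentiableAt ℝ f p ∧ pd1 f p = ψ' * (a + d * p.2) ∧ pd2 f p = ψ p.1 * d := by
  have h1 : HasFDerivAt (fun q : ℝ × ℝ => ψ q.1) (ψ' • ContinuousLinearMap.fst ℝ ℝ ℝ) p :=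
    hψ.comp_hasFDerivAt p hasFDerivAt_fst
  have h2 : HasFDerivAt (fun q : ℝ × ℝ => a + d * q.2) (d • ContinuousLinearMap.snd ℝ ℝ ℝ) p :=
    (hasFDerivAt_snd.const_mul d).const_add a
  have h3 := h1.mul h2
  have h4 := h3.congr_of_eventuallyEq (f₁ := f)
    (Filter.eventually_of_mem (aux_open.mem_nhds hp) (fun q hq => hf q hq))
  refine ⟨h4.differentiableAt, ?_, ?_⟩
  · simp [pd1, h4.fderiv]; ring
  · simp [pd2, h4.fderiv]

lemma aux_smooth {f : ℝ × ℝ → ℝ} (hf : ContDiffOn ℝ (⊤ : ℕ∞) f {p : ℝ × ℝ | 0 < p.1})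
    (v : ℝ × ℝ) :
    ContDiffOn ℝ (⊤ : ℕ∞) (fun p => fderiv ℝ f p v) {p : ℝ × ℝ | 0 < p.1} :=
  (hf.fderiv_of_isOpen aux_open (m := (⊤ : ℕ∞)) (by simp)).clm_apply contDiffOn_const

lemma aux_diff {f : ℝ × ℝ → ℝ} (hf : ContDiffOn ℝ (⊤ : ℕ∞) f {p : ℝ × ℝ | 0 < p.1})
    (p : ℝ × ℝ) (hp : 0 < p.1) : DifferentiableAt ℝ f p :=
  (hf.contDiffAt (aux_open.mem_nhds hp)).differentiableAt (by simp)

lemma aux_symm {f : ℝ × ℝ → ℝ} (hf : ContDiffOn ℝ (⊤ : ℕ∞) f {p : ℝ × ℝ | 0 < p.1})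
    (p : ℝ × ℝ) (hp : 0 < p.1) : pd2 (pd1 f) p = pd1 (pd2 f) p := by
  have hc := hf.contDiffAt (aux_open.mem_nhds hp)
  have hs : IsSymmSndFDerivAt ℝ f p := hc.isSymmSndFDerivAt (by
    simp only [minSmoothness_of_isRCLikeNormedField]; exact WithTop.coe_le_coe.2 (le_top (a := (2 : ℕ∞))))
  have hd : DifferentiableAt ℝ (fderiv ℝ f) p :=
    (hc.fderiv_right (m := 1) (by norm_cast)).differentiableAt (by simp)
  have h := hs (0, 1) (1, 0)
  have e : ∀ v w : ℝ × ℝ, fderiv ℝ (fun q => fderiv ℝ f q v) p w = fderiv ℝ (fderiv ℝ f) p w v := by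
    intro v w
    rw [fderiv_clm_apply hd (differentiableAt_const v)]
    simp
  unfold pd1 pd2
  rw [e, e, h]

/-- For the Type B connection with Γ₁₁¹ = b/x¹, Γ₁₂² = (b+1)/x¹, Γ₂₂¹ = ε/x¹
(b ≠ −3, b ≠ −1, ε = ±1, others zero, ρ_s = −2ε(x¹)⁻²dx²⊗dx²) on {x¹ > 0} and the
eigenvalue μ = (b+1)/2, the smooth solutions of the affine quasi-Einstein equation are
exactly the span of (x¹)^{b+1} and (x¹)^{b+1} x². -/
theorem stmt19 (b ε μ : ℝ) (hb3 : b ≠ -3) (hb1 : b ≠ -1) (hε : ε = 1 ∨ ε = -1)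
    (hμ : μ = (b + 1) / 2) (f : ℝ × ℝ → ℝ) :
    (ContDiffOn ℝ (⊤ : ℕ∞) f {p : ℝ × ℝ | 0 < p.1} ∧
      ∀ p : ℝ × ℝ, 0 < p.1 →
        pd1 (pd1 f) p - (b / p.1) * pd1 f p = 0 ∧
        pd1 (pd2 f) p - ((b + 1) / p.1) * pd2 f p = 0 ∧
        pd2 (pd2 f) p - (ε / p.1) * pd1 f p
          = -(ε * (b + 1) / p.1 ^ 2) * f p) ↔
    (∃ a d : ℝ, ∀ p : ℝ × ℝ, 0 < p.1 →
      f p = a * p.1 ^ (b + 1) + d * (p.1 ^ (b + 1) * p.2)) := by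
  constructor
  · rintro ⟨hf, hE⟩
    have hf1 : ContDiffOn ℝ (⊤ : ℕ∞) (pd1 f) {p : ℝ × ℝ | 0 < p.1} := aux_smooth hf (1, 0)
    have hf2 : ContDiffOn ℝ (⊤ : ℕ∞) (pd2 f) {p : ℝ × ℝ | 0 < p.1} := aux_smooth hf (0, 1)
    have d0 := aux_diff hf
    have d1 := aux_diff hf1
    have d2 := aux_diff hf2
    have hε0 : ε ≠ 0 := by rcases hε with h | h <;> rw [h] <;> norm_num
    -- coordinate and power functions
    have hX : ∀ p : ℝ × ℝ, 0 < p.1 → _ := fun p hp =>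
      aux_prod (fun q => q.1) id 1 0 1 p hp (by simp) (hasDerivAt_id _)
    have hY : ∀ p : ℝ × ℝ, 0 < p.1 → _ := fun p hp =>
      aux_prod (fun q => q.2) (fun _ => 1) 0 1 0 p hp (by simp) (hasDerivAt_const _ _)
    have hC : ∀ c : ℝ, ∀ p : ℝ × ℝ, 0 < p.1 → _ := fun c p hp =>
      aux_prod (fun q => c) (fun _ => c) 1 0 0 p hp (by simp) (hasDerivAt_const _ _)
    have hP : ∀ p : ℝ × ℝ, 0 < p.1 → _ := fun p hp =>
      aux_prod (fun q => q.1 ^ (-(b + 1))) (fun x => x ^ (-(b + 1))) 1 0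
        (-(b + 1) * p.1 ^ (-(b + 1) - 1)) p hp (by simp)
        (Real.hasDerivAt_rpow_const (Or.inl hp.ne'))
    obtain ⟨K, hK⟩ := aux_const (fun q => (b + 1) * f q - q.1 * pd1 f q)
      (fun p hp => ((d0 p hp).const_mul _).sub ((hX p hp).1.fun_mul (d1 p hp)))
      (fun p hp => by
        rw [aux_sub1 ((d0 p hp).const_mul _) ((hX p hp).1.fun_mul (d1 p hp)),
          aux_mul1 (hC (b + 1) p hp).1 (d0 p hp), aux_mul1 (hX p hp).1 (d1 p hp),
          (hC (b + 1) p hp).2.1, (hX p hp).2.1]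
        have h := (hE p hp).1
        field_simp at h
        linear_combination -h)
      (fun p hp => by
        rw [aux_sub2 ((d0 p hp).const_mul _) ((hX p hp).1.fun_mul (d1 p hp)),
          aux_mul2 (hC (b + 1) p hp).1 (d0 p hp), aux_mul2 (hX p hp).1 (d1 p hp),
          (hC (b + 1) p hp).2.2, (hX p hp).2.2, aux_symm hf p hp]
        have h := (hE p hp).2.1
        field_simp at h
        linear_combination -h)
    have h22 : ∀ p : ℝ × ℝ, 0 < p.1 → pd2 (pd2 f) p = (-(ε * K)) * (p.1 ^ 2)⁻¹ := by
      intro p hp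
      have h := (hE p hp).2.2
      have hk := hK p hp
      rw [← hk]
      field_simp at h ⊢
      linear_combination h
    have hK0 : K = 0 := by
      have hp : (0 : ℝ) < ((1, 0) : ℝ × ℝ).1 := by simp
      have hL := (aux_prod (pd2 (pd2 f)) (fun x => (-(ε * K)) * (x ^ 2)⁻¹) 1 0
        (2 * (ε * K)) (1, 0) hp (by intro q hq; rw [h22 q hq]; ring)
        (by
          have := ((hasDerivAt_pow 2 (1 : ℝ)).inv (by norm_num)).const_mul (-(ε * K))
          have e : 2 * (ε * K) = -(ε * K) * (-(((2 : ℕ) : ℝ) * 1 ^ (2 - 1)) / (1 ^ 2) ^ 2) := by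
            norm_num
            ring
          rw [e]
          exact this)).2.1
      have hs := aux_symm hf2 (1, 0) hp
      rw [hL] at hs
      have hev : pd1 (pd2 f) =ᶠ[nhds (1, 0)] fun q => (b + 1) * (q.1⁻¹ * pd2 f q) :=
        Filter.eventually_of_mem (aux_open.mem_nhds hp) (fun q hq => by
          have h := (hE q hq).2.1
          simp only
          rw [div_eq_mul_inv] at h
          linear_combination h)
      have hI := aux_prod (fun q => q.1⁻¹) (fun x => x⁻¹) 1 0 (-(1 ^ 2)⁻¹) (1, 0) hp (by simp)
        (hasDerivAt_inv one_ne_zero)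
      have e2 : pd2 (pd1 (pd2 f)) (1, 0) = pd2 (fun q => (b + 1) * (q.1⁻¹ * pd2 f q)) (1, 0) := by
        unfold pd2 at hev ⊢
        rw [hev.fderiv_eq]
      rw [e2, aux_mul2 (hC (b + 1) _ hp).1 (hI.1.fun_mul (d2 _ hp)), (hC (b + 1) _ hp).2.2,
        aux_mul2 hI.1 (d2 _ hp), hI.2.2, h22 _ hp] at hs
      have hb : b + 3 ≠ 0 := fun h => hb3 (by linarith)
      have : (b + 3) * ε * K = 0 := by
        norm_num at hs
        linear_combination -hs
      simpa [hb, hε0] using this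
    subst hK0
    obtain ⟨d, hd⟩ := aux_const (fun q => q.1 ^ (-(b + 1)) * pd2 f q)
      (fun p hp => (hP p hp).1.fun_mul (d2 p hp))
      (fun p hp => by
        rw [aux_mul1 (hP p hp).1 (d2 p hp), (hP p hp).2.1, Real.rpow_sub_one hp.ne']
        have h := (hE p hp).2.1
        field_simp at h ⊢
        linear_combination p.1 ^ (-(b + 1)) * h)
      (fun p hp => by
        rw [aux_mul2 (hP p hp).1 (d2 p hp), (hP p hp).2.2, h22 p hp]
        ring)
    have hdY : ∀ p : ℝ × ℝ, 0 < p.1 → DifferentiableAt ℝ (fun q : ℝ × ℝ => d * q.2) p :=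
      fun p hp => (hC d p hp).1.fun_mul (hY p hp).1
    obtain ⟨a, ha⟩ := aux_const (fun q => q.1 ^ (-(b + 1)) * f q - d * q.2)
      (fun p hp => ((hP p hp).1.fun_mul (d0 p hp)).sub (hdY p hp))
      (fun p hp => by
        rw [aux_sub1 ((hP p hp).1.fun_mul (d0 p hp)) (hdY p hp), aux_mul1 (hP p hp).1 (d0 p hp),
          aux_mul1 (hC d p hp).1 (hY p hp).1, (hC d p hp).2.1, (hY p hp).2.1, (hP p hp).2.1,
          Real.rpow_sub_one hp.ne']
        have h := hK p hp
        field_simp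
        linear_combination -p.1 ^ (-(b + 1)) * h)
      (fun p hp => by
        rw [aux_sub2 ((hP p hp).1.fun_mul (d0 p hp)) (hdY p hp), aux_mul2 (hP p hp).1 (d0 p hp),
          aux_mul2 (hC d p hp).1 (hY p hp).1, (hC d p hp).2.2, (hY p hp).2.2, (hP p hp).2.2]
        have h := hd p hp
        linear_combination h)
    refine ⟨a, d, fun p hp => ?_⟩
    have h := ha p hp
    have hm : p.1 ^ (b + 1) * p.1 ^ (-(b + 1)) = 1 := by
      rw [← Real.rpow_add hp]; simp
    linear_combination p.1 ^ (b + 1) * h - f p * hm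
  · rintro ⟨a, d, hf⟩
    have hr : ∀ c : ℝ, ∀ x : ℝ, 0 < x → HasDerivAt (fun x : ℝ => x ^ c) (c * x ^ (c - 1)) x :=
      fun c x hx => Real.hasDerivAt_rpow_const (Or.inl hx.ne')
    have hA : ∀ p : ℝ × ℝ, 0 < p.1 → _ := fun p hp =>
      aux_prod f (fun x => x ^ (b + 1)) a d _ p hp
        (fun q hq => by rw [hf q hq]; ring) (hr _ _ hp)
    have hA1 : ∀ p : ℝ × ℝ, 0 < p.1 → _ := fun p hp =>
      aux_prod (pd1 f) (fun x => (b + 1) * x ^ (b + 1 - 1)) a d _ p hp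
        (fun q hq => (hA q hq).2.1) ((hr _ _ hp).const_mul _)
    have hA2 : ∀ p : ℝ × ℝ, 0 < p.1 → _ := fun p hp =>
      aux_prod (pd2 f) (fun x => x ^ (b + 1)) d 0 _ p hp
        (fun q hq => by rw [(hA q hq).2.2]; ring) (hr _ _ hp)
    constructor
    · have : ContDiffOn ℝ (⊤ : ℕ∞) (fun p : ℝ × ℝ => a * p.1 ^ (b + 1) + d * (p.1 ^ (b + 1) * p.2))
          {p : ℝ × ℝ | 0 < p.1} := by
        have hx : ContDiffOn ℝ (⊤ : ℕ∞) (fun p : ℝ × ℝ => p.1 ^ (b + 1)) {p : ℝ × ℝ | 0 < p.1} :=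
          contDiffOn_fst.rpow_const_of_ne (fun p hp => ne_of_gt hp)
        exact (contDiffOn_const.mul hx).add (contDiffOn_const.mul (hx.mul contDiffOn_snd))
      exact this.congr (fun p hp => hf p hp)
    · intro p hp
      rw [(hA1 p hp).2.1, (hA2 p hp).2.1, (hA2 p hp).2.2, (hA p hp).2.1, (hA p hp).2.2, hf p hp]
      simp only [Real.rpow_sub_one hp.ne']
      refine ⟨?_, ?_, ?_⟩
      · field_simp; ring
      · field_simp; ring
      · field_simp; ring
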